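/- For all natural numbers n and k, restriction to the first k+1 elements gives a bijection between the set of order-preserving maps f: Fin(2k+2) → Fin(n+1) satisfying the equivariance condition f(2k+1−i) = n − f(i) for all i, and the set of all order-preserving maps Fin(k+1) → Fin(⌊n/2⌋+1). -/

import Mathlib

/-- The order-preserving map `Fin (2k+2) → Fin (n+1)` that agrees with `g` on the first half and
with the order-reversed conjugate of `g` on the second half. -/
def revExtend {n k : ℕ} (g : Fin (k + 1) →o Fin (n / 2 + 1)) :
    Fin (2 * k + 2) →o Fin (n + 1) where
  toFun i :=
    if h : (i : ℕ) < k + 1 then ⟨g ⟨i, h⟩, by omega⟩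
    else ⟨n - g ⟨2 * k + 1 - i, by omega⟩, by omega⟩
  monotone' := by
    intro a b hab
    have hab' : (a : ℕ) ≤ b := hab
    rw [Fin.le_def]
    dsimp only
    split_ifs with ha hb hb
    · exact g.monotone (Fin.mk_le_mk.2 hab')
    · dsimp only
      omega
    · omega
    · have h : (g ⟨2 * k + 1 - b, by omega⟩ : ℕ) ≤ g ⟨2 * k + 1 - a, by omega⟩ :=
        g.monotone (Fin.mk_le_mk.2 (by omega))
      dsimp only
      omega

theorem revExtend_of_lt {n k : ℕ} (g : Fin (k + 1) →o Fin (n / 2 + 1)) {i : Fin (2 * k + 2)}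
    (h : (i : ℕ) < k + 1) : (revExtend g i : ℕ) = g ⟨i, h⟩ :=
  congrArg Fin.val (dif_pos h)

theorem revExtend_of_not_lt {n k : ℕ} (g : Fin (k + 1) →o Fin (n / 2 + 1)) {i : Fin (2 * k + 2)}
    (h : ¬ (i : ℕ) < k + 1) : (revExtend g i : ℕ) = n - g ⟨2 * k + 1 - i, by omega⟩ :=
  congrArg Fin.val (dif_neg h)

theorem revExtend_castLE {n k : ℕ} (g : Fin (k + 1) →o Fin (n / 2 + 1))
    (h : k + 1 ≤ 2 * k + 2) (j : Fin (k + 1)) :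
    (revExtend g (Fin.castLE h j) : ℕ) = g j :=
  revExtend_of_lt g j.isLt

theorem revExtend_rev {n k : ℕ} (g : Fin (k + 1) →o Fin (n / 2 + 1)) (i : Fin (2 * k + 2)) :
    revExtend g i.rev = (revExtend g i).rev := by
  have hrev : (i.rev : ℕ) = 2 * k + 1 - i := by rw [Fin.val_rev]; omega
  apply Fin.ext
  rw [Fin.val_rev]
  by_cases hi : (i : ℕ) < k + 1
  · have h : 2 * k + 1 - (i.rev : ℕ) = i := by omega
    rw [revExtend_of_lt g hi, revExtend_of_not_lt g (by omega)]
    simp only [h]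
    omega
  · rw [revExtend_of_not_lt g hi, revExtend_of_lt g (by omega)]
    simp only [hrev]
    omega

/-- A map commuting with order reversal is determined by its values on the first half. -/
theorem eq_of_rev_of_eq_castLE {n k : ℕ} {f f' : Fin (2 * k + 2) →o Fin (n + 1)}
    (hf : ∀ i, f i.rev = (f i).rev) (hf' : ∀ i, f' i.rev = (f' i).rev) (hk : k + 1 ≤ 2 * k + 2)
    (h : ∀ j : Fin (k + 1), f (Fin.castLE hk j) = f' (Fin.castLE hk j)) : f = f' := by
  have key (i : Fin (2 * k + 2)) (hi : (i : ℕ) < k + 1) : f i = f' i := h ⟨i, hi⟩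
  ext1
  funext i
  by_cases hi : (i : ℕ) < k + 1
  · exact key i hi
  · have := key i.rev (by rw [Fin.val_rev]; omega)
    rwa [hf, hf', Fin.rev_inj] at this


/-- For all natural numbers `n` and `k`, restriction to the first `k+1` elements gives a
bijection between order-preserving maps `f : Fin (2k+2) → Fin (n+1)` satisfying the
equivariance condition `f ((2k+1) - i) = n - f i` (expressed via `Fin.rev`) and all
order-preserving maps `Fin (k+1) → Fin (n/2 + 1)`.  The first clause records that the
restriction indeed lands in `Fin (n/2 + 1)`; the second clause says that restriction is a
bijection onto the set of all order-preserving maps `Fin (k+1) → Fin (n/2 + 1)`. -/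
theorem stmt1 (n k : ℕ) :
    (∀ f : Fin (2 * k + 2) →o Fin (n + 1), (∀ i, f i.rev = (f i).rev) →
      ∀ j : Fin (k + 1), ((f (Fin.castLE (by omega) j) : ℕ) ≤ n / 2)) ∧
    (∀ g : Fin (k + 1) →o Fin (n / 2 + 1),
      ∃! f : {f : Fin (2 * k + 2) →o Fin (n + 1) // ∀ i, f i.rev = (f i).rev},
        ∀ j : Fin (k + 1), ((f.1 (Fin.castLE (by omega) j) : ℕ) = (g j : ℕ))) := by
  refine ⟨fun f hf j => ?_, fun g => ?_⟩
  · have hle : f (Fin.castLE (by omega) j) ≤ f (Fin.castLE (by omega) j).rev :=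
      f.monotone (by rw [Fin.le_def, Fin.val_rev, Fin.val_castLE]; omega)
    rw [hf, Fin.le_def, Fin.val_rev] at hle
    omega
  · refine ⟨⟨revExtend g, revExtend_rev g⟩, revExtend_castLE g _, fun f hf => Subtype.ext ?_⟩
    exact eq_of_rev_of_eq_castLE f.2 (revExtend_rev g) (by omega)
      fun j => Fin.ext ((hf j).trans (revExtend_castLE g _ j).symm)
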